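/- arXiv:2110.06551 — 2 statements merged into one kernel-verified Lean document; each statement's English description precedes it below -/
import Mathlib

section
/- For every agent i there exists a challenge scheme x(·,·) for the SCF f such that for every state θ̃ ∈ Θ and every type θ_i ∈ Θ_i, u_i(x(θ̃,θ_i),θ_i) ≥ u_i(x(θ̃,θ_i'),θ_i) for all θ_i' ∈ Θ_i. -/
/-!
STATEMENT 2 (Lemma 1, best challenge scheme): For every agent i there exists a challenge
scheme x(·,·) for the SCF f such that for every state θ̃ ∈ Θ and every type θ_i ∈ Θ_i,
u_i(x(θ̃,θ_i),θ_i) ≥ u_i(x(θ̃,θ_i'),θ_i) for all θ_i' ∈ Θ_i.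
-/

open scoped BigOperators Classical

noncomputable section

/-- The outcome space `X = Δ(A) × ℝ^I`. -/
abbrev Outc (A : Type) (I : ℕ) : Type := PMF A × (Fin I → ℝ)

/-- Expected utility of a countably supported lottery under Bernoulli utility `t`. -/
def eu {A : Type} (t : A → ℝ) (ℓ : PMF A) : ℝ := ∑' a, (ℓ a).toReal * t a

/-- Agent `i`'s quasilinear utility at an outcome, given his type `t` (an expected-utility
function represented by Bernoulli utilities `t : A → ℝ`). -/
def uTy {A : Type} {I : ℕ} (i : Fin I) (x : Outc A I) (t : A → ℝ) : ℝ :=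
  eu t x.1 + x.2 i

/-- The type of agent `i` at state `θ`: the expected-utility function `v_i(·,θ)`. -/
def typeOf {A Θ : Type} {I : ℕ} (w : Fin I → A → Θ → ℝ) (i : Fin I) (θ : Θ) : A → ℝ :=
  fun a => w i a θ

/-- Lower-contour set `𝓛_i(x, t)` of `x` for type `t`. -/
def lowerC {A : Type} {I : ℕ} (i : Fin I) (x : Outc A I) (t : A → ℝ) : Set (Outc A I) :=
  {x' | uTy i x' t ≤ uTy i x t}

/-- Strict upper-contour set `𝓢𝓤_i(x, t)` of `x` for type `t`. -/
def strictUpperC {A : Type} {I : ℕ} (i : Fin I) (x : Outc A I) (t : A → ℝ) : Set (Outc A I) :=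
  {x' | uTy i x t < uTy i x' t}

/-- A challenge scheme for the SCF `f` and agent `i`: for each state `θ̃` and type
`θ_i ∈ Θ_i`, it selects a test allocation in `𝓛_i(f(θ̃),θ̃_i) ∩ 𝓢𝓤_i(f(θ̃),θ_i)` whenever
this set is nonempty, and `f(θ̃)` otherwise. -/
def IsChallengeScheme {A Θ : Type} {I : ℕ} (w : Fin I → A → Θ → ℝ) (f : Θ → Outc A I)
    (i : Fin I) (xs : Θ → (A → ℝ) → Outc A I) : Prop :=
  ∀ (θ' : Θ) (t : A → ℝ), t ∈ Set.range (typeOf w i) →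
    ((lowerC i (f θ') (typeOf w i θ') ∩ strictUpperC i (f θ') t).Nonempty →
      xs θ' t ∈ lowerC i (f θ') (typeOf w i θ') ∩ strictUpperC i (f θ') t) ∧
    (¬ (lowerC i (f θ') (typeOf w i θ') ∩ strictUpperC i (f θ') t).Nonempty →
      xs θ' t = f θ')

/-- For a finite family of preferences, each one admitting an improvement on `y` inside `L` can
be assigned such an improvement that it likes at least as much as those assigned to the others. -/
theorem exists_mutually_best_improvement {X J : Type} [Finite J] (u : X → J → ℝ)
    (L : Set X) (y : X) :
    ∃ g : J → X, ∀ j, ((L ∩ {x | u y j < u x j}).Nonempty → g j ∈ L ∩ {x | u y j < u x j}) ∧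
      (¬ (L ∩ {x | u y j < u x j}).Nonempty → g j = y) ∧ ∀ k, u (g k) j ≤ u (g j) j := by
  let P : J → Prop := fun j => (L ∩ {x | u y j < u x j}).Nonempty
  choose c hc using fun j : {j // P j} => j.2
  have hmax : ∀ j : {j // P j}, ∃ m, ∀ k, u (c k) j ≤ u (c m) j := fun j => by
    have : Nonempty {j // P j} := ⟨j⟩
    exact Finite.exists_max fun k => u (c k) j
  choose m hm using hmax
  have himp : ∀ j : {j // P j}, u y j < u (c (m j)) j :=
    fun j => (hc j).2.trans_le (hm j j)
  refine ⟨fun j => if h : P j then c (m ⟨j, h⟩) else y, fun j => ⟨fun h => ?_, fun h => ?_,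
    fun k => ?_⟩⟩
  · simp only [dif_pos (show P j from h)]
    exact ⟨(hc _).1, himp ⟨j, h⟩⟩
  · exact dif_neg h
  · by_cases hj : P j <;> by_cases hk : P k <;> simp only [hj, hk, dif_pos, dif_neg, not_false_eq_true]
    · exact hm ⟨j, hj⟩ _
    · exact (himp ⟨j, hj⟩).le
    · exact not_lt.mp fun hlt => hj ⟨_, (hc _).1, hlt⟩
    · exact le_rfl

/-- **Lemma 1**: there is a challenge scheme under which truthfully reporting one's type
is a (weakly) best challenge. -/
theorem exists_best_challenge_scheme
    {A Θ : Type} {I : ℕ} [Fintype Θ] [Nonempty A] (hI : 2 ≤ I)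
    (w : Fin I → A → Θ → ℝ) (B : ℝ) (hB : ∀ i a θ, |w i a θ| ≤ B)
    (f : Θ → Outc A I) :
    ∀ i : Fin I, ∃ xs : Θ → (A → ℝ) → Outc A I,
      IsChallengeScheme w f i xs ∧
      ∀ (θ' : Θ) (t t' : A → ℝ), t ∈ Set.range (typeOf w i) → t' ∈ Set.range (typeOf w i) →
        uTy i (xs θ' t') t ≤ uTy i (xs θ' t) t := by
  intro i
  have : Finite (Set.range (typeOf w i)) := Set.finite_range _
  choose g hg using fun θ' : Θ =>
    exists_mutually_best_improvement
      (fun (x : Outc A I) (t : Set.range (typeOf w i)) => uTy i x t)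
      (lowerC i (f θ') (typeOf w i θ')) (f θ')
  refine ⟨fun θ' t => if h : t ∈ Set.range (typeOf w i) then g θ' ⟨t, h⟩ else f θ', ?_, ?_⟩
  · intro θ' t ht
    simp only [dif_pos ht]
    exact ⟨(hg θ' ⟨t, ht⟩).1, (hg θ' ⟨t, ht⟩).2.1⟩
  · intro θ' t t' ht ht'
    simp only [dif_pos ht, dif_pos ht']
    exact (hg θ' ⟨t, ht⟩).2.2 ⟨t', ht'⟩

end
end

section
/- For each agent i ∈ 𝓘 there exists a collection of outcomes {y_i(θ_i)}_{θ_i∈Θ_i} ⊆ X such that: (1) for all types θ_i, θ_i' ∈ Θ_i with θ_i ≠ θ_i', u_i(y_i(θ_i),θ_i) > u_i(y_i(θ_i'),θ_i); and (2) for each agent j ∈ 𝓘, each type θ_j' ∈ Θ_j, and every x ∈ X̃, u_i(y_j(θ_j'),θ_i) < u_i(x,θ_i). -/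
/-!
STATEMENT 3 (Lemma 2, dictator lotteries): For each agent i there exists a collection of
outcomes {y_i(θ_i)}_{θ_i ∈ Θ_i} ⊆ X such that (1) for all distinct types θ_i ≠ θ_i' in
Θ_i, u_i(y_i(θ_i),θ_i) > u_i(y_i(θ_i'),θ_i); and (2) for each agent j, each type
θ_j' ∈ Θ_j, and every x ∈ X̃, u_i(y_j(θ_j'),θ_i) < u_i(x,θ_i).
-/

open scoped BigOperators Classical

noncomputable section

/-- Each pure alternative `a ∈ A` identified with the outcome `(δ_a, 0, …, 0) ∈ X`. -/
def embA {A : Type} {I : ℕ} (a : A) : Outc A I := (PMF.pure a, fun _ => 0)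

/-- The finite set `X̃ = A ∪ ⋃_{i ∈ 𝓘, θ_i ∈ Θ_i, θ̃ ∈ Θ} {x(θ̃,θ_i)}`. -/
def Xtilde {A Θ : Type} {I : ℕ} (w : Fin I → A → Θ → ℝ)
    (xs : ∀ _ : Fin I, Θ → (A → ℝ) → Outc A I) : Set (Outc A I) :=
  Set.range (embA (I := I)) ∪
    ⋃ (i : Fin I) (θ' : Θ) (θ : Θ), {xs i θ' (typeOf w i θ)}

/-- A finitely supported probability vector defines a lottery whose expected utility is the
corresponding finite sum. -/
lemma exists_pmf_eu_eq_sum {A : Type} (S : Finset A) (q : A → ℝ) (hq : ∀ a ∈ S, 0 ≤ q a)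
    (hsum : ∑ a ∈ S, q a = 1) :
    ∃ ℓ : PMF A, ∀ t : A → ℝ, eu t ℓ = ∑ a ∈ S, q a * t a := by
  refine ⟨PMF.ofFinset (fun a => if a ∈ S then ENNReal.ofReal (q a) else 0) S ?_ ?_, fun t => ?_⟩
  · rw [Finset.sum_congr rfl (fun a ha => if_pos ha), ← ENNReal.ofReal_sum_of_nonneg hq, hsum,
      ENNReal.ofReal_one]
  · intro a ha
    exact if_neg ha
  · unfold eu
    rw [tsum_eq_sum (s := S)]
    · refine Finset.sum_congr rfl fun a ha => ?_
      simp [PMF.ofFinset_apply, ha, ENNReal.toReal_ofReal (hq a ha)]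
    · intro a ha
      simp [PMF.ofFinset_apply, ha]

lemma eu_pure {A : Type} (t : A → ℝ) (a : A) : eu t (PMF.pure a) = t a := by
  unfold eu
  rw [tsum_eq_single a]
  · simp
  · intro b hb
    simp [PMF.pure_apply, hb]

/-- Lotteries that shift mass from `a₀` to the alternatives in `S` in proportion to a bounded
Bernoulli utility `s`, normalized at `a₀`. -/
lemma exists_lottery_eu_eq_inner {A : Type} (a₀ : A) (S : Finset A) (ha₀ : a₀ ∈ S)
    {B : ℝ} (hB : 0 ≤ B) :
    ∃ ε : ℝ, 0 < ε ∧ ∀ s : A → ℝ, (∀ a, |s a| ≤ B) → ∃ ℓ : PMF A,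
      (∀ t : A → ℝ, eu t ℓ = t a₀ + ε * ∑ a ∈ S, (s a - s a₀ + 2 * B) * (t a - t a₀)) ∧
      ∀ (t : A → ℝ) (C : ℝ), (∀ a, t a ≤ C) → eu t ℓ ≤ C := by
  have hn : (0 : ℝ) < S.card := by exact_mod_cast Finset.card_pos.2 ⟨a₀, ha₀⟩
  have hd : 0 < (S.card : ℝ) * (4 * B + 1) := by positivity
  refine ⟨1 / (S.card * (4 * B + 1)), by positivity, fun s hs => ?_⟩
  set ε : ℝ := 1 / (S.card * (4 * B + 1)) with hε
  have hε_pos : 0 < ε := by positivity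
  set p : A → ℝ := fun a => ε * (s a - s a₀ + 2 * B) with hp
  have hp_nonneg : ∀ a, 0 ≤ p a := fun a => by
    have h₁ := abs_le.1 (hs a)
    have h₂ := abs_le.1 (hs a₀)
    exact mul_nonneg hε_pos.le (by linarith)
  have hp_sum : ∑ a ∈ S, p a ≤ 1 := by
    calc ∑ a ∈ S, p a ≤ ∑ a ∈ S, ε * (4 * B + 1) := by
          refine Finset.sum_le_sum fun a _ => mul_le_mul_of_nonneg_left ?_ hε_pos.le
          have h₁ := abs_le.1 (hs a)
          have h₂ := abs_le.1 (hs a₀)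
          linarith
      _ = 1 := by
          rw [Finset.sum_const, nsmul_eq_mul, hε]
          field_simp
  set q : A → ℝ := fun a => (if a = a₀ then 1 - ∑ b ∈ S, p b else 0) + p a with hq
  have hq_nonneg : ∀ a ∈ S, 0 ≤ q a := fun a _ => by
    refine add_nonneg ?_ (hp_nonneg a)
    split_ifs <;> linarith
  have hq_sum : ∑ a ∈ S, q a = 1 := by
    simp [hq, Finset.sum_add_distrib, Finset.sum_ite_eq', ha₀]
  obtain ⟨ℓ, hℓ⟩ := exists_pmf_eu_eq_sum S q hq_nonneg hq_sum
  refine ⟨ℓ, fun t => ?_, fun t C hC => ?_⟩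
  · have h₁ : ∑ a ∈ S, q a * t a = (1 - ∑ b ∈ S, p b) * t a₀ + ∑ a ∈ S, p a * t a := by
      simp [hq, add_mul, Finset.sum_add_distrib, ite_mul, Finset.sum_ite_eq', ha₀]
    have h₂ : ε * ∑ a ∈ S, (s a - s a₀ + 2 * B) * (t a - t a₀)
        = ∑ a ∈ S, p a * t a - (∑ b ∈ S, p b) * t a₀ := by
      rw [Finset.mul_sum, Finset.sum_mul, ← Finset.sum_sub_distrib]
      refine Finset.sum_congr rfl fun a _ => ?_
      simp only [hp]
      ring
    rw [hℓ, h₁, h₂]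
    ring
  · calc eu t ℓ = ∑ a ∈ S, q a * t a := hℓ t
      _ ≤ ∑ a ∈ S, q a * C :=
          Finset.sum_le_sum fun a ha => mul_le_mul_of_nonneg_left (hC a) (hq_nonneg a ha)
      _ = C := by rw [← Finset.sum_mul, hq_sum, one_mul]

/-- Utilities of agents over `Xtilde` are uniformly bounded below. -/
lemma exists_lower_bound_Xtilde {A Θ : Type} {I : ℕ} [Finite Θ]
    (w : Fin I → A → Θ → ℝ) (B : ℝ) (hB : ∀ i a θ, |w i a θ| ≤ B)
    (xs : ∀ _ : Fin I, Θ → (A → ℝ) → Outc A I) :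
    ∃ L : ℝ, ∀ i : Fin I, ∀ t ∈ Set.range (typeOf w i), ∀ x ∈ Xtilde w xs, L ≤ uTy i x t := by
  obtain ⟨m, hm⟩ := (Set.finite_range (fun k : Fin I × Θ × Fin I × Θ × Θ =>
    uTy k.1 (xs k.2.2.1 k.2.2.2.1 (typeOf w k.2.2.1 k.2.2.2.2)) (typeOf w k.1 k.2.1))).bddBelow
  refine ⟨min m (-B), ?_⟩
  rintro i _ ⟨θ, rfl⟩ x (⟨a, rfl⟩ | hx)
  · refine (min_le_right _ _).trans ?_
    simpa [uTy, embA, eu_pure, typeOf] using (abs_le.1 (hB i a θ)).1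
  · simp only [Set.mem_iUnion, Set.mem_singleton_iff] at hx
    obtain ⟨j, θ', θ'', rfl⟩ := hx
    exact (min_le_left _ _).trans (hm ⟨(i, θ, j, θ', θ''), rfl⟩)

/-- A finite set of alternatives separates the types of every agent up to additive constants. -/
lemma exists_finset_separating_types {A Θ : Type} {I : ℕ} [Finite Θ] (a₀ : A)
    (w : Fin I → A → Θ → ℝ)
    (hdistinct : ∀ (i : Fin I) (θ θ' : Θ), typeOf w i θ ≠ typeOf w i θ' →
      ¬ ∃ α β : ℝ, 0 < α ∧ ∀ a, typeOf w i θ' a = α * typeOf w i θ a + β) :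
    ∃ S : Finset A, a₀ ∈ S ∧ ∀ (i : Fin I) (t t' : A → ℝ), t ∈ Set.range (typeOf w i) →
      t' ∈ Set.range (typeOf w i) → t ≠ t' → ∃ a ∈ S, t a - t a₀ ≠ t' a - t' a₀ := by
  have h : ∀ k : Fin I × Θ × Θ, ∃ a, typeOf w k.1 k.2.1 ≠ typeOf w k.1 k.2.2 →
      typeOf w k.1 k.2.1 a - typeOf w k.1 k.2.1 a₀
        ≠ typeOf w k.1 k.2.2 a - typeOf w k.1 k.2.2 a₀ := by
    rintro ⟨i, θ, θ'⟩
    by_contra! hcon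
    refine hdistinct i θ θ' (hcon a₀).1
      ⟨1, typeOf w i θ' a₀ - typeOf w i θ a₀, one_pos, fun a => ?_⟩
    linarith [(hcon a).2]
  choose g hg using h
  refine ⟨insert a₀ (Set.finite_range g).toFinset, Finset.mem_insert_self _ _, ?_⟩
  rintro i _ _ ⟨θ, rfl⟩ ⟨θ', rfl⟩ hne
  exact ⟨g (i, θ, θ'), by simp, hg (i, θ, θ') hne⟩

/-- **Lemma 2 (dictator lotteries)**. -/
theorem exists_dictator_lotteries
    {A Θ : Type} {I : ℕ} [Fintype Θ] [Nonempty A] (hI : 2 ≤ I)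
    (w : Fin I → A → Θ → ℝ) (B : ℝ) (hB : ∀ i a θ, |w i a θ| ≤ B)
    (f : Θ → Outc A I)
    -- distinct types induce distinct preference orderings over Δ(A): neither is a
    -- positive affine transformation of the other
    (hdistinct : ∀ (i : Fin I) (θ θ' : Θ), typeOf w i θ ≠ typeOf w i θ' →
      ¬ ∃ α β : ℝ, 0 < α ∧ ∀ a, typeOf w i θ' a = α * typeOf w i θ a + β)
    (xs : ∀ _ : Fin I, Θ → (A → ℝ) → Outc A I)
    (hxs : ∀ i, IsChallengeScheme w f i (xs i)) :
    ∃ y : Fin I → (A → ℝ) → Outc A I,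
      (∀ i : Fin I, ∀ t ∈ Set.range (typeOf w i), ∀ t' ∈ Set.range (typeOf w i),
        t ≠ t' → uTy i (y i t') t < uTy i (y i t) t) ∧
      (∀ i j : Fin I, ∀ t ∈ Set.range (typeOf w i), ∀ t' ∈ Set.range (typeOf w j),
        ∀ x ∈ Xtilde w xs, uTy i (y j t') t < uTy i x t) := by
  obtain ⟨a₀⟩ := ‹Nonempty A›
  obtain ⟨S, ha₀, hS⟩ := exists_finset_separating_types a₀ w hdistinct
  obtain ⟨L, hL⟩ := exists_lower_bound_Xtilde w B hB xs
  obtain ⟨ε, hε, hlot⟩ := exists_lottery_eu_eq_inner a₀ S ha₀ (abs_nonneg B)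
  have hbound : ∀ i, ∀ t ∈ Set.range (typeOf w i), ∀ a, |t a| ≤ |B| := by
    rintro i _ ⟨θ, rfl⟩ a
    exact (hB i a θ).trans (le_abs_self B)
  have hlot' : ∀ s : A → ℝ, ∃ ℓ : PMF A, (∀ a, |s a| ≤ |B|) →
      (∀ t : A → ℝ, eu t ℓ = t a₀ + ε * ∑ a ∈ S, (s a - s a₀ + 2 * |B|) * (t a - t a₀)) ∧
      ∀ (t : A → ℝ) (C : ℝ), (∀ a, t a ≤ C) → eu t ℓ ≤ C := by
    intro s
    by_cases hs : ∀ a, |s a| ≤ |B|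
    · obtain ⟨ℓ, hℓ⟩ := hlot s hs
      exact ⟨ℓ, fun _ => hℓ⟩
    · exact ⟨PMF.pure a₀, fun h => absurd h hs⟩
  choose ℓ hℓ using hlot'
  refine ⟨fun _ s => (ℓ s, fun _ => -(ε / 2 * ∑ a ∈ S, (s a - s a₀) ^ 2) - (|B| - L + 1)),
    ?_, ?_⟩
  · intro i t ht t' ht' hne
    obtain ⟨a, ha, hne_a⟩ := hS i t t' ht ht' hne
    have hpos : 0 < ε / 2 * ∑ a ∈ S, ((t a - t a₀) - (t' a - t' a₀)) ^ 2 := by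
      refine mul_pos (by positivity) (Finset.sum_pos' (fun _ _ => sq_nonneg _) ⟨a, ha, ?_⟩)
      exact sq_pos_of_ne_zero (sub_ne_zero.2 hne_a)
    have hid : ε / 2 * ∑ a ∈ S, ((t a - t a₀) - (t' a - t' a₀)) ^ 2
        = (ε * ∑ a ∈ S, (t a - t a₀ + 2 * |B|) * (t a - t a₀)
            - ε / 2 * ∑ a ∈ S, (t a - t a₀) ^ 2)
          - (ε * ∑ a ∈ S, (t' a - t' a₀ + 2 * |B|) * (t a - t a₀)
            - ε / 2 * ∑ a ∈ S, (t' a - t' a₀) ^ 2) := by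
      simp only [Finset.mul_sum, ← Finset.sum_sub_distrib]
      exact Finset.sum_congr rfl fun a _ => by ring
    simp only [uTy]
    rw [(hℓ t (hbound i t ht)).1 t, (hℓ t' (hbound i t' ht')).1 t]
    linarith
  · intro i j t ht t' ht' x hx
    have h₁ := (hℓ t' (hbound j t' ht')).2 t |B| fun a => (abs_le.1 (hbound i t ht a)).2
    have h₂ := hL i t ht x hx
    have h₃ : 0 ≤ ε / 2 * ∑ a ∈ S, (t' a - t' a₀) ^ 2 := by positivity
    simp only [uTy] at h₂ ⊢
    linarith

end
end
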